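/- Let n ∈ ℕ and let y belong to the closure of X_n in E(𝓕). Then for every integer k > n, t*_{σ^{2k²}(s(y))} = sup_{i≥1} F^{−i}(|s_{2k²+i}(y)|) ≥ F^{k−n}(1) − 1. -/

import Mathlib

noncomputable section
open Topology Filter TopologicalSpace

/- The dynamical model: F(t) = 3^t − 1 acting on ℝ × ℤ^ω (ℤ discrete, product topology). -/

/-- `F t = 3 ^ t - 1` (real exponent). -/
def F : ℝ → ℝ := fun t => (3 : ℝ) ^ t - 1

/-- The inverse of `F` on `[0, ∞)`: `F⁻¹ t = log₃ (t + 1)`. -/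
def Finv : ℝ → ℝ := fun t => Real.logb 3 (t + 1)

/-- The shift map on integer sequences. -/
def shift : (ℕ → ℤ) → (ℕ → ℤ) := fun s n => s (n + 1)

/-- The map 𝓕(t, s) = (F(t) − |s₀|, σ(s)). -/
def calF : ℝ × (ℕ → ℤ) → ℝ × (ℕ → ℤ) :=
  fun x => (F x.1 - (|x.2 0| : ℝ), shift x.2)

/-- J(𝓕) = {x : T(𝓕ⁿ(x)) ≥ 0 for all n ≥ 0} (the case n = 0 forces T(x) ≥ 0). -/
def J : Set (ℝ × (ℕ → ℤ)) := {x | ∀ n : ℕ, 0 ≤ (calF^[n] x).1}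

/-- 𝕊 = {s ∈ ℤ^ω : (t, s) ∈ J(𝓕) for some t ≥ 0}. -/
def Sset : Set (ℕ → ℤ) := {s | ∃ t : ℝ, 0 ≤ t ∧ (t, s) ∈ J}

/-- t_s = min {t ≥ 0 : (t, s) ∈ J(𝓕)} (as an infimum; for s ∈ 𝕊 it is attained). -/
def tmin (s : ℕ → ℤ) : ℝ := sInf {t : ℝ | (t, s) ∈ J}

/-- The endpoint set E(𝓕) = {(t_s, s) : s ∈ 𝕊}, a subspace of ℝ × ℤ^ω. -/
def Efan : Set (ℝ × (ℕ → ℤ)) := {x | x.2 ∈ Sset ∧ x.1 = tmin x.2}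

/-- t*_s = sup_{k ≥ 1} F^{−k}(|s_k|). -/
def tstar (s : ℕ → ℤ) : ℝ := ⨆ k : ℕ, Finv^[k + 1] (|s (k + 1)| : ℝ)

/-- X_n = {x ∈ E(𝓕) : t*_{σ^{2k²}(s(x))} > F^{k−n}(1) for all k > n}. -/
def Xfan (n : ℕ) : Set ↥Efan :=
  {x | ∀ k : ℕ, n < k → F^[k - n] 1 < tstar (shift^[2 * k ^ 2] (x : ℝ × (ℕ → ℤ)).2)}

lemma F_mono : Monotone F := fun a b h => by
  have : (3 : ℝ) ^ a ≤ 3 ^ b := Real.rpow_le_rpow_of_exponent_le (by norm_num) h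
  unfold F
  linarith

lemma F_zero : F 0 = 0 := by simp [F]

lemma F_nonneg {t : ℝ} (ht : 0 ≤ t) : 0 ≤ F t := F_zero ▸ F_mono ht

lemma nonneg_of_F_nonneg {t : ℝ} (ht : 0 ≤ F t) : 0 ≤ t := by
  by_contra! h
  have : (3 : ℝ) ^ t < 1 := Real.rpow_lt_one_of_one_lt_of_neg (by norm_num) h
  unfold F at ht
  linarith

lemma F_Finv {u : ℝ} (hu : 0 ≤ u) : F (Finv u) = u := by
  unfold F Finv
  rw [Real.rpow_logb (by norm_num) (by norm_num) (by linarith)]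
  ring

lemma Finv_F (t : ℝ) : Finv (F t) = t := by
  simp only [F, Finv, sub_add_cancel]
  exact Real.logb_rpow (by norm_num) (by norm_num)

lemma Finv_mono {u v : ℝ} (hu : 0 ≤ u) (h : u ≤ v) : Finv u ≤ Finv v :=
  Real.logb_le_logb_of_le (by norm_num) (by linarith) (by linarith)

lemma Finv_nonneg {u : ℝ} (hu : 0 ≤ u) : 0 ≤ Finv u :=
  Real.logb_nonneg (by norm_num) (by linarith)

lemma Finv_iterate_nonneg {u : ℝ} (hu : 0 ≤ u) (k : ℕ) : 0 ≤ Finv^[k] u := by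
  induction k with
  | zero => exact hu
  | succ k ih =>
    rw [Function.iterate_succ_apply']
    exact Finv_nonneg ih

lemma Finv_le {u t : ℝ} (hu : 0 ≤ u) (h : u ≤ F t) : Finv u ≤ t :=
  (Finv_mono hu h).trans_eq (Finv_F t)

lemma le_F {u t : ℝ} (hu : 0 ≤ u) (h : Finv u ≤ t) : u ≤ F t :=
  (F_Finv hu).symm.trans_le (F_mono h)

lemma le_F_iterate (k : ℕ) {u t : ℝ} (hu : 0 ≤ u) (h : Finv^[k] u ≤ t) : u ≤ F^[k] t := by
  induction k generalizing t with
  | zero => exact h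
  | succ k ih =>
    rw [Function.iterate_succ_apply'] at h
    rw [Function.iterate_succ_apply]
    exact ih (le_F (Finv_iterate_nonneg hu k) h)

lemma calF_mem_J {x : ℝ × (ℕ → ℤ)} (hx : x ∈ J) : calF x ∈ J := fun n => hx (n + 1)

lemma mem_J_of_calF_mem {x : ℝ × (ℕ → ℤ)} (hx : calF x ∈ J) : x ∈ J := by
  intro n
  cases n with
  | zero =>
    have h : 0 ≤ F x.1 - (|x.2 0| : ℝ) := hx 0
    exact nonneg_of_F_nonneg (h.trans (sub_le_self _ (abs_nonneg _)))
  | succ n => exact hx n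

lemma Finv_add_mem_J {s : ℕ → ℤ} {u : ℝ} (hu : (u, shift s) ∈ J) :
    (Finv (u + |(s 0 : ℝ)|), s) ∈ J := by
  have h0 : 0 ≤ u := hu 0
  apply mem_J_of_calF_mem
  simpa [calF, F_Finv (add_nonneg h0 (abs_nonneg (s 0 : ℝ)))] using hu

lemma shift_mem_Sset {s : ℕ → ℤ} (hs : s ∈ Sset) : shift s ∈ Sset := by
  obtain ⟨t, -, h⟩ := hs
  exact ⟨_, calF_mem_J h 0, calF_mem_J h⟩

lemma tmin_le {s : ℕ → ℤ} {t : ℝ} (h : (t, s) ∈ J) : tmin s ≤ t :=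
  csInf_le ⟨0, fun _ hu => hu 0⟩ h

lemma le_tmin {s : ℕ → ℤ} (hs : s ∈ Sset) {a : ℝ} (h : ∀ t, (t, s) ∈ J → a ≤ t) :
    a ≤ tmin s := by
  obtain ⟨t, -, ht⟩ := hs
  exact le_csInf ⟨t, ht⟩ h

lemma tmin_nonneg {s : ℕ → ℤ} (hs : s ∈ Sset) : 0 ≤ tmin s :=
  le_tmin hs fun _ h => h 0

/-- The minimal potential satisfies the functional equation `F t_s = t_{σ s} + |s₀|`. -/
lemma F_tmin_sub {s : ℕ → ℤ} (hs : s ∈ Sset) :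
    F (tmin s) - |(s 0 : ℝ)| = tmin (shift s) := by
  have hs' := shift_mem_Sset hs
  have h0 : 0 ≤ tmin (shift s) + |(s 0 : ℝ)| := add_nonneg (tmin_nonneg hs') (abs_nonneg _)
  apply le_antisymm
  · refine le_tmin hs' fun u hu => ?_
    have hu0 : 0 ≤ u + |(s 0 : ℝ)| := add_nonneg (hu 0) (abs_nonneg _)
    have h := F_mono (tmin_le (Finv_add_mem_J hu))
    rw [F_Finv hu0] at h
    linarith
  · have h : Finv (tmin (shift s) + |(s 0 : ℝ)|) ≤ tmin s := by
      refine le_tmin hs fun t ht => Finv_le h0 ?_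
      have h1 : tmin (shift s) ≤ F t - |(s 0 : ℝ)| := tmin_le (calF_mem_J ht)
      linarith
    linarith [le_F h0 h]

lemma calF_mem_Efan {x : ℝ × (ℕ → ℤ)} (hx : x ∈ Efan) : calF x ∈ Efan := by
  refine ⟨shift_mem_Sset hx.1, ?_⟩
  change F x.1 - |(x.2 0 : ℝ)| = tmin (shift x.2)
  rw [hx.2, F_tmin_sub hx.1]

lemma calF_iterate_mem_Efan {x : ℝ × (ℕ → ℤ)} (hx : x ∈ Efan) (m : ℕ) :
    calF^[m] x ∈ Efan := by
  induction m with
  | zero => exact hx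
  | succ m ih =>
    rw [Function.iterate_succ_apply']
    exact calF_mem_Efan ih

lemma calF_iterate_snd (x : ℝ × (ℕ → ℤ)) (m : ℕ) : (calF^[m] x).2 = shift^[m] x.2 := by
  induction m with
  | zero => rfl
  | succ m ih => rw [Function.iterate_succ_apply', Function.iterate_succ_apply', ← ih, calF]

lemma calF_iterate_fst {x : ℝ × (ℕ → ℤ)} (hx : x ∈ Efan) (m : ℕ) :
    (calF^[m] x).1 = tmin (shift^[m] x.2) := by
  rw [(calF_iterate_mem_Efan hx m).2, calF_iterate_snd]

lemma shift_iterate_mem_Sset {s : ℕ → ℤ} (hs : s ∈ Sset) (m : ℕ) : shift^[m] s ∈ Sset := by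
  induction m with
  | zero => exact hs
  | succ m ih =>
    rw [Function.iterate_succ_apply']
    exact shift_mem_Sset ih

lemma Finv_iterate_le_of_mem_J (k : ℕ) {t : ℝ} {s : ℕ → ℤ} (h : (t, s) ∈ J) :
    Finv^[k + 1] |(s k : ℝ)| ≤ t := by
  induction k generalizing t s with
  | zero =>
    have h1 : 0 ≤ F t - |(s 0 : ℝ)| := calF_mem_J h 0
    exact Finv_le (abs_nonneg _) (by linarith)
  | succ k ih =>
    have h1 : Finv^[k + 1] |(s (k + 1) : ℝ)| ≤ F t - |(s 0 : ℝ)| := ih (calF_mem_J h)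
    rw [Function.iterate_succ_apply']
    exact Finv_le (Finv_iterate_nonneg (abs_nonneg _) _) (by linarith [abs_nonneg (s 0 : ℝ)])

lemma tstar_le_tmin_shift {s : ℕ → ℤ} (hs : s ∈ Sset) : tstar s ≤ tmin (shift s) :=
  le_tmin (shift_mem_Sset hs) fun _ ht => ciSup_le fun k => Finv_iterate_le_of_mem_J k ht

lemma mem_J_of_abs_le {s : ℕ → ℤ} {C t : ℝ} (hC : 0 ≤ C)
    (h : ∀ k, |(s k : ℝ)| ≤ F^[k + 1] C) (ht : C + 1 ≤ t) : (t, s) ∈ J := by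
  intro n
  induction n generalizing s C t with
  | zero => exact le_trans (by linarith) ht
  | succ n ih =>
    refine ih (F_nonneg hC) (fun k => h (k + 1)) ?_
    have h0 : |(s 0 : ℝ)| ≤ F C := h 0
    have h1 : F (C + 1) ≤ F t := F_mono ht
    have h2 : F (C + 1) = 3 * F C + 2 := by
      unfold F
      rw [Real.rpow_add (by norm_num), Real.rpow_one]
      ring
    change F C + 1 ≤ F t - |(s 0 : ℝ)|
    linarith [F_nonneg hC]

lemma tmin_shift_le_tstar_add_one {s : ℕ → ℤ} (hs : s ∈ Sset) :
    tmin (shift s) ≤ tstar s + 1 := by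
  obtain ⟨t, -, ht⟩ := shift_mem_Sset hs
  have hbdd : BddAbove (Set.range fun k : ℕ => Finv^[k + 1] |(s (k + 1) : ℝ)|) := by
    refine ⟨t, ?_⟩
    rintro _ ⟨k, rfl⟩
    exact Finv_iterate_le_of_mem_J k ht
  have hle : ∀ k : ℕ, Finv^[k + 1] |(s (k + 1) : ℝ)| ≤ tstar s := le_ciSup hbdd
  refine tmin_le (mem_J_of_abs_le ?_ (fun k => ?_) le_rfl)
  · exact (Finv_iterate_nonneg (abs_nonneg _) _).trans (hle 0)
  · exact le_F_iterate (k + 1) (abs_nonneg _) (hle k)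

lemma continuous_calF : Continuous calF := by
  have hF : Continuous F :=
    (Real.continuous_const_rpow (by norm_num : (3 : ℝ) ≠ 0)).sub continuous_const
  have h0 : Continuous fun x : ℝ × (ℕ → ℤ) => (x.2 0 : ℝ) :=
    continuous_of_discreteTopology.comp ((continuous_apply 0).comp continuous_snd)
  refine ((hF.comp continuous_fst).sub h0.abs).prodMk ?_
  exact continuous_pi fun n => (continuous_apply (n + 1)).comp continuous_snd

/-- If y is in the closure of Xₙ in E(𝓕), then for every k > n one has
t*_{σ^{2k²}(s(y))} ≥ F^{k−n}(1) − 1. -/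
theorem tstar_ge_of_mem_closure_Xfan (n : ℕ) (y : ↥Efan) (hy : y ∈ closure (Xfan n))
    (k : ℕ) (hk : n < k) :
    F^[k - n] 1 - 1 ≤ tstar (shift^[2 * k ^ 2] (y : ℝ × (ℕ → ℤ)).2) := by
  set N := 2 * k ^ 2
  have hS (x : ↥Efan) := shift_iterate_mem_Sset x.2.1 N
  have hT (x : ↥Efan) : (calF^[N + 1] x).1 = tmin (shift (shift^[N] (x : ℝ × (ℕ → ℤ)).2)) := by
    rw [calF_iterate_fst x.2, Function.iterate_succ_apply']
  have hclosed : IsClosed {x : ↥Efan | F^[k - n] 1 ≤ (calF^[N + 1] x).1} :=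
    isClosed_le continuous_const
      (continuous_fst.comp ((continuous_calF.iterate _).comp continuous_subtype_val))
  have hsub : Xfan n ⊆ {x : ↥Efan | F^[k - n] 1 ≤ (calF^[N + 1] x).1} := fun x hx =>
    (hx k hk).le.trans ((tstar_le_tmin_shift (hS x)).trans_eq (hT x).symm)
  have hmem : F^[k - n] 1 ≤ (calF^[N + 1] y).1 := closure_minimal hsub hclosed hy
  linarith [hT y, tmin_shift_le_tstar_add_one (hS y)]
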